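/- For every constant c > 0 there exist ε > 0 and σ₀ > 0, with ε independent of σ, such that for all 0 < σ < σ₀, all x in the interval I = [−1−cσ, −1+cσ], and all measurable J ⊆ I: K̂_σ(x,J) ≥ ε·μ(J), where μ is the uniform probability distribution on I (i.e., μ(J) = Leb(J)/(2cσ)). -/

import Mathlib

open MeasureTheory Filter Set

/-- Gaussian density `φ_σ` with mean 0 and variance `σ²`. -/
noncomputable def gaussDensity (σ x : ℝ) : ℝ :=
  (Real.sqrt (2 * Real.pi * σ ^ 2))⁻¹ * Real.exp (-(x ^ 2) / (2 * σ ^ 2))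

/-- Density `f_σ` of the mixture `½ N(-1,σ²) + ½ N(1,σ²)`. -/
noncomputable def mixDensity (σ x : ℝ) : ℝ :=
  (1 / 2) * gaussDensity σ (x + 1) + (1 / 2) * gaussDensity σ (x - 1)

/-- The `N(0,σ²)` measure, defined via its density `φ_σ` w.r.t. Lebesgue measure. -/
noncomputable def gaussMeasure (σ : ℝ) : Measure ℝ :=
  volume.withDensity fun z => ENNReal.ofReal (gaussDensity σ z)

/-- The random-walk Metropolis kernel `K_σ(x, ·)` as a measure: the accepted-move part
has density `min(1, f_σ(y)/f_σ(x))` w.r.t. the proposal `x + N(0,σ²)`, and the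
remaining mass `1 − ∫ min(1, f_σ(x+z)/f_σ(x)) φ_σ(z) dz` stays at `x`. -/
noncomputable def rwmKernel (σ : ℝ) (x : ℝ) : Measure ℝ :=
  ((gaussMeasure σ).map (fun z => x + z)).withDensity
      (fun y => ENNReal.ofReal (min 1 (mixDensity σ y / mixDensity σ x)))
  + (ENNReal.ofReal
      (1 - ∫ z, min 1 (mixDensity σ (x + z) / mixDensity σ x) * gaussDensity σ z))
      • Measure.dirac x

/-- The restricted Metropolis–Hastings kernel `K̂_σ` on `(-∞,0)`:
`K̂_σ(x,A) = K_σ(x, A ∩ (-∞,0)) + 1_A(x) K_σ(x,[0,∞))`. -/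
noncomputable def rwmKernelHat (σ : ℝ) (x : ℝ) : Measure ℝ :=
  (rwmKernel σ x).restrict (Set.Iio 0) + (rwmKernel σ x (Set.Ici 0)) • Measure.dirac x

theorem gaussDensity_nonneg (σ x : ℝ) : 0 ≤ gaussDensity σ x := by
  unfold gaussDensity; positivity

theorem gaussDensity_le (σ x : ℝ) : gaussDensity σ x ≤ (Real.sqrt (2 * Real.pi * σ ^ 2))⁻¹ := by
  unfold gaussDensity
  refine mul_le_of_le_one_right (by positivity) (Real.exp_le_one_iff.2 ?_)
  exact div_nonpos_of_nonpos_of_nonneg (by nlinarith [sq_nonneg x]) (by positivity)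

theorem le_gaussDensity_of_abs_le {σ a x : ℝ} (hσ : 0 < σ) (hx : |x| ≤ a * σ) :
    (Real.sqrt (2 * Real.pi * σ ^ 2))⁻¹ * Real.exp (-(a ^ 2 / 2)) ≤ gaussDensity σ x := by
  unfold gaussDensity
  gcongr
  have h : x ^ 2 ≤ (a * σ) ^ 2 := sq_le_sq' (neg_le_of_abs_le hx) (le_of_abs_le hx)
  rw [neg_div, neg_le_neg_iff, div_le_div_iff₀ (by positivity) (by norm_num)]
  nlinarith

theorem mixDensity_le (σ x : ℝ) : mixDensity σ x ≤ (Real.sqrt (2 * Real.pi * σ ^ 2))⁻¹ := by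
  have h₁ := gaussDensity_le σ (x + 1)
  have h₂ := gaussDensity_le σ (x - 1)
  unfold mixDensity
  linarith

theorem mixDensity_pos {σ : ℝ} (hσ : 0 < σ) (x : ℝ) : 0 < mixDensity σ x := by
  unfold mixDensity gaussDensity
  positivity

/-- The acceptance probability of a move to `y` is bounded below if `y` is near the mode `-1`. -/
theorem le_min_one_mixDensity_div {σ c : ℝ} (hσ : 0 < σ) (x : ℝ) {y : ℝ}
    (hy : |y + 1| ≤ c * σ) :
    1 / 2 * Real.exp (-(c ^ 2 / 2)) ≤ min 1 (mixDensity σ y / mixDensity σ x) := by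
  have hexp : Real.exp (-(c ^ 2 / 2)) ≤ 1 := Real.exp_le_one_iff.2 (by nlinarith [sq_nonneg c])
  refine le_min (by linarith) ?_
  rw [le_div_iff₀ (mixDensity_pos hσ x)]
  calc 1 / 2 * Real.exp (-(c ^ 2 / 2)) * mixDensity σ x
      ≤ 1 / 2 * Real.exp (-(c ^ 2 / 2)) * (Real.sqrt (2 * Real.pi * σ ^ 2))⁻¹ := by
        gcongr; exact mixDensity_le σ x
    _ ≤ 1 / 2 * gaussDensity σ (y + 1) := by
        linarith [le_gaussDensity_of_abs_le hσ hy]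
    _ ≤ mixDensity σ y := by
        unfold mixDensity
        linarith [gaussDensity_nonneg σ (y - 1)]

/-- A lower bound for the proposal density on `J` bounds the proposal measure of `J`. -/
theorem ofReal_mul_volume_le_map_gaussMeasure {σ x b : ℝ} {J : Set ℝ} (hJ : MeasurableSet J)
    (hb : ∀ y ∈ J, b ≤ gaussDensity σ (y - x)) :
    ENNReal.ofReal b * volume J ≤ (gaussMeasure σ).map (fun z => x + z) J := by
  have hT : Measurable fun z : ℝ => x + z := measurable_const_add x
  have hvol : volume ((fun z => x + z) ⁻¹' J) = volume J := measure_preimage_add volume x J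
  rw [Measure.map_apply hT hJ, gaussMeasure, withDensity_apply _ (hT hJ), ← hvol,
    ← setLIntegral_const]
  refine setLIntegral_mono' (hT hJ) fun z hz => ENNReal.ofReal_le_ofReal ?_
  simpa using hb (x + z) hz

/-- Moves accepted inside the negative half-line are moves of the restricted kernel. -/
theorem ofReal_mul_map_le_rwmKernelHat {σ x a : ℝ} {J : Set ℝ} (hJ : MeasurableSet J)
    (hneg : J ⊆ Iio 0) (ha : ∀ y ∈ J, a ≤ min 1 (mixDensity σ y / mixDensity σ x)) :
    ENNReal.ofReal a * (gaussMeasure σ).map (fun z => x + z) J ≤ rwmKernelHat σ x J := by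
  rw [rwmKernelHat, Measure.add_apply, Measure.restrict_eq_self _ hneg]
  refine le_add_right ?_
  rw [rwmKernel, Measure.add_apply, withDensity_apply _ hJ]
  refine le_add_right ?_
  rw [← setLIntegral_const]
  exact setLIntegral_mono' hJ fun y hy => ENNReal.ofReal_le_ofReal (ha y hy)

/-- Minorization of `K̂_σ` on the interval `I = [-1-cσ, -1+cσ]` by `ε` times the uniform
distribution `μ` on `I` (so `μ(J) = Leb(J)/(2cσ)`), with `ε` independent of `σ`. -/
theorem stmt11 (c : ℝ) (hc : 0 < c) :
    ∃ ε : ℝ, 0 < ε ∧ ∃ σ₀ : ℝ, 0 < σ₀ ∧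
      ∀ σ : ℝ, 0 < σ → σ < σ₀ →
        ∀ x ∈ Set.Icc (-1 - c * σ) (-1 + c * σ),
          ∀ J ⊆ Set.Icc (-1 - c * σ) (-1 + c * σ), MeasurableSet J →
            ENNReal.ofReal ε * ((ENNReal.ofReal (2 * c * σ))⁻¹ * volume J)
              ≤ rwmKernelHat σ x J := by
  refine ⟨c * (Real.sqrt (2 * Real.pi))⁻¹ * (Real.exp (-(c ^ 2 / 2)) *
    Real.exp (-((2 * c) ^ 2 / 2))), by positivity, c⁻¹, by positivity, ?_⟩
  intro σ hσ hσc x hx J hJI hJ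
  have hcσ : c * σ < 1 := by
    have := mul_lt_mul_of_pos_left hσc hc
    rwa [mul_inv_cancel₀ hc.ne'] at this
  have hneg : J ⊆ Iio 0 := fun y hy => by
    have := (hJI hy).2
    exact mem_Iio.2 (by linarith)
  have hmove := ofReal_mul_map_le_rwmKernelHat (x := x) hJ hneg fun y hy =>
    le_min_one_mixDensity_div (c := c) hσ x (abs_le.2
      ⟨by linarith [(hJI hy).1], by linarith [(hJI hy).2]⟩)
  have hprop := ofReal_mul_volume_le_map_gaussMeasure (x := x) hJ fun y hy =>
    le_gaussDensity_of_abs_le (a := 2 * c) hσ (abs_le.2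
      ⟨by linarith [(hJI hy).1, hx.2], by linarith [(hJI hy).2, hx.1]⟩)
  refine le_trans (le_of_eq ?_) ((mul_le_mul_right hprop _).trans hmove)
  rw [← mul_assoc, ← mul_assoc (ENNReal.ofReal (1 / 2 * _)),
    ← ENNReal.ofReal_inv_of_pos (by positivity),
    ← ENNReal.ofReal_mul (by positivity), ← ENNReal.ofReal_mul (by positivity),
    Real.sqrt_mul (by positivity) (σ ^ 2), Real.sqrt_sq hσ.le]
  congr 2
  field_simp
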